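/- arXiv:1507.02775 — 4 statements merged into one kernel-verified Lean document; each statement's English description precedes it below -/
import Mathlib

section
/- (Lower bound of Theorem 1.1 with Neumann boundary condition, pointwise form.) Let b > 0, R > 0, C₀ ≥ 0 and let E < 0 be a real number such that E_blk(v; b, R) ≥ R²E − C₀R for every v in the Neumann class N_R. Then for every u ∈ N_R one has E_lin(u; b, R) ≥ (−R·√(−2E) − C₀·(−2E)^{−1/2})·(∫_{Q_R}|u|⁴ dx)^{1/2}. In particular the constrained Neumann ground-state energy m^N(b,R) = inf{ E_lin(u;b,R)/(∫_{Q_R}|u|⁴)^{1/2} : u ∈ N_R, u ≠ 0 } satisfies m^N(b,R) ≥ −R√(−2E) − C₀(−2E)^{−1/2}. -/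
open MeasureTheory

noncomputable section

/-- The vector potential `A₀(x₁,x₂) = (−x₂/2, x₁/2)`, generating a unit magnetic field. -/
def A0 (x : ℝ × ℝ) : ℝ × ℝ := (-x.2 / 2, x.1 / 2)

/-- `|(∇−iA₀)u|²`, the squared modulus of the magnetic gradient of `u`. -/
def magGradSq (u : ℝ × ℝ → ℂ) (x : ℝ × ℝ) : ℝ :=
  ‖fderiv ℝ u x (1, 0) - Complex.I * ((A0 x).1 : ℂ) * u x‖ ^ 2 +
  ‖fderiv ℝ u x (0, 1) - Complex.I * ((A0 x).2 : ℂ) * u x‖ ^ 2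

/-- The open square `Q_R = (−R/2,R/2) × (−R/2,R/2)`. -/
def QR (R : ℝ) : Set (ℝ × ℝ) := Set.Ioo (-R / 2) (R / 2) ×ˢ Set.Ioo (-R / 2) (R / 2)

/-- The bulk energy `E_blk(u;b,R) = ∫_{Q_R} (b|(∇−iA₀)u|² − |u|² + ½|u|⁴)`. -/
def Eblk (u : ℝ × ℝ → ℂ) (b R : ℝ) : ℝ :=
  ∫ x in QR R, (b * magGradSq u x - ‖u x‖ ^ 2 + (1 / 2) * ‖u x‖ ^ 4)

/-- The linear energy `E_lin(u;b,R) = ∫_{Q_R} (b|(∇−iA₀)u|² − |u|²)`. -/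
def Elin (u : ℝ × ℝ → ℂ) (b R : ℝ) : ℝ :=
  ∫ x in QR R, (b * magGradSq u x - ‖u x‖ ^ 2)

/-- The Dirichlet class `D_R`: functions `C¹` on the closure of `Q_R` vanishing on `∂Q_R`. -/
def DirichletClass (u : ℝ × ℝ → ℂ) (R : ℝ) : Prop :=
  ContDiffOn ℝ 1 u (closure (QR R)) ∧ ∀ x ∈ frontier (QR R), u x = 0

/-- The Neumann class `N_R`: functions `C¹` on the closure of `Q_R`. -/
def NeumannClass (u : ℝ × ℝ → ℂ) (R : ℝ) : Prop :=
  ContDiffOn ℝ 1 u (closure (QR R))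

/-- The magnetic Laplacian `(∇−iA₀)²u = Δu − 2i A₀·∇u − |A₀|²u` (using `div A₀ = 0`). -/
def magLap (u : ℝ × ℝ → ℂ) (x : ℝ × ℝ) : ℂ :=
  (fderiv ℝ (fun y => fderiv ℝ u y (1, 0)) x (1, 0) +
   fderiv ℝ (fun y => fderiv ℝ u y (0, 1)) x (0, 1))
  - 2 * Complex.I * (((A0 x).1 : ℂ) * fderiv ℝ u x (1, 0) +
                     ((A0 x).2 : ℂ) * fderiv ℝ u x (0, 1))
  - (((A0 x).1 ^ 2 + (A0 x).2 ^ 2 : ℝ) : ℂ) * u x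

/-- The constrained Dirichlet ground-state energy
`m^D(b,R) = inf { E_lin(u;b,R) / (∫_{Q_R}|u|⁴)^{1/2} : u ∈ D_R, u ≠ 0 }`. -/
def mD (b R : ℝ) : ℝ :=
  sInf {m : ℝ | ∃ u : ℝ × ℝ → ℂ, DirichletClass u R ∧ u ≠ 0 ∧
    m = Elin u b R / Real.sqrt (∫ x in QR R, ‖u x‖ ^ 4)}

/-- The constrained Neumann ground-state energy
`m^N(b,R) = inf { E_lin(u;b,R) / (∫_{Q_R}|u|⁴)^{1/2} : u ∈ N_R, u ≠ 0 }`. -/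
def mN (b R : ℝ) : ℝ :=
  sInf {m : ℝ | ∃ u : ℝ × ℝ → ℂ, NeumannClass u R ∧ u ≠ 0 ∧
    m = Elin u b R / Real.sqrt (∫ x in QR R, ‖u x‖ ^ 4)}

/-- The outward unit normal of the square `Q_R` (at non-corner boundary points). -/
def nuSq (R : ℝ) (x : ℝ × ℝ) : ℝ × ℝ :=
  (if x.1 = R / 2 then 1 else if x.1 = -R / 2 then -1 else 0,
   if x.2 = R / 2 then 1 else if x.2 = -R / 2 then -1 else 0)

/-- The corner points of the square `Q_R`. -/
def IsCornerPt (R : ℝ) (x : ℝ × ℝ) : Prop :=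
  (x.1 = R / 2 ∨ x.1 = -R / 2) ∧ (x.2 = R / 2 ∨ x.2 = -R / 2)

/-- The magnetic Neumann boundary condition `ν·(∇−iA₀)u = 0` at non-corner points of `∂Q_R`. -/
def MagNeumannBC (u : ℝ × ℝ → ℂ) (R : ℝ) : Prop :=
  ∀ x ∈ frontier (QR R), ¬ IsCornerPt R x →
    ((nuSq R x).1 : ℂ) * (fderiv ℝ u x (1, 0) - Complex.I * ((A0 x).1 : ℂ) * u x) +
    ((nuSq R x).2 : ℂ) * (fderiv ℝ u x (0, 1) - Complex.I * ((A0 x).2 : ℂ) * u x) = 0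

lemma isOpen_QR (R : ℝ) : IsOpen (QR R) := isOpen_Ioo.prod isOpen_Ioo

lemma isCompact_closure_QR (R : ℝ) : IsCompact (closure (QR R)) :=
  ((Metric.isBounded_Ioo _ _).prod (Metric.isBounded_Ioo _ _)).isCompact_closure

lemma uniqueDiffOn_closure_QR (R : ℝ) : UniqueDiffOn ℝ (closure (QR R)) := by
  rcases (QR R).eq_empty_or_nonempty with h | h
  · simp [h, uniqueDiffOn_empty]
  · have hconv : Convex ℝ (QR R) := (convex_Ioo _ _).prod (convex_Ioo _ _)
    refine uniqueDiffOn_convex hconv.closure (h.mono ?_)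
    exact interior_maximal subset_closure (isOpen_QR R)

lemma integrableOn_QR_of_continuousOn_closure {f : ℝ × ℝ → ℝ} {R : ℝ}
    (hf : ContinuousOn f (closure (QR R))) : IntegrableOn f (QR R) :=
  (hf.integrableOn_compact (isCompact_closure_QR R)).mono_set subset_closure

lemma NeumannClass.integrableOn_norm_pow {u : ℝ × ℝ → ℂ} {R : ℝ} (hu : NeumannClass u R)
    (n : ℕ) : IntegrableOn (fun x => ‖u x‖ ^ n) (QR R) :=
  integrableOn_QR_of_continuousOn_closure (hu.continuousOn.norm.pow n)

lemma NeumannClass.integrableOn_magGradSq {u : ℝ × ℝ → ℂ} {R : ℝ} (hu : NeumannClass u R) :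
    IntegrableOn (magGradSq u) (QR R) := by
  have hd : ContinuousOn (fderivWithin ℝ u (closure (QR R))) (closure (QR R)) :=
    ContDiffOn.continuousOn_fderivWithin hu (uniqueDiffOn_closure_QR R) le_rfl
  have hc := hu.continuousOn
  have hA : Continuous A0 := by unfold A0; fun_prop
  have hint : IntegrableOn (fun x =>
      ‖fderivWithin ℝ u (closure (QR R)) x (1, 0) - Complex.I * ((A0 x).1 : ℂ) * u x‖ ^ 2 +
      ‖fderivWithin ℝ u (closure (QR R)) x (0, 1) - Complex.I * ((A0 x).2 : ℂ) * u x‖ ^ 2)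
      (QR R) := by
    apply integrableOn_QR_of_continuousOn_closure
    fun_prop
  refine hint.congr_fun (fun x hx => ?_) (isOpen_QR R).measurableSet
  have hx' : closure (QR R) ∈ nhds x :=
    Filter.mem_of_superset ((isOpen_QR R).mem_nhds hx) subset_closure
  simp only [magGradSq, fderivWithin_of_mem_nhds hx']

lemma NeumannClass.const_smul {u : ℝ × ℝ → ℂ} {R : ℝ} (hu : NeumannClass u R) (t : ℝ) :
    NeumannClass (t • u) R :=
  ContDiffOn.const_smul t hu

lemma magGradSq_const_smul (u : ℝ × ℝ → ℂ) (t : ℝ) (x : ℝ × ℝ) :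
    magGradSq (t • u) x = t ^ 2 * magGradSq u x := by
  have h (a c : ℂ) : ‖t • a - c * (t • u x)‖ ^ 2 = t ^ 2 * ‖a - c * u x‖ ^ 2 := by
    rw [mul_smul_comm, ← smul_sub, norm_smul, mul_pow, Real.norm_eq_abs, sq_abs]
  simp only [magGradSq, fderiv_const_smul_field, Pi.smul_apply,
    smul_apply, h]
  ring

/-- The bulk energy of a rescaled function, split into its quadratic and quartic parts. -/
lemma Eblk_const_smul {u : ℝ × ℝ → ℂ} {R : ℝ} (hu : NeumannClass u R) (b t : ℝ) :
    Eblk (t • u) b R =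
      t ^ 2 * Elin u b R + (t ^ 2) ^ 2 / 2 * ∫ x in QR R, ‖u x‖ ^ 4 := by
  have hlin : IntegrableOn (fun x => b * magGradSq u x - ‖u x‖ ^ 2) (QR R) :=
    (hu.integrableOn_magGradSq.const_mul b).sub (hu.integrableOn_norm_pow 2)
  unfold Eblk Elin
  rw [← integral_const_mul, ← integral_const_mul,
    ← integral_add (hlin.const_mul _) ((hu.integrableOn_norm_pow 4).const_mul _)]
  congr 1
  ext x
  have h4 : |t| ^ 4 = (t ^ 2) ^ 2 := by rw [← sq_abs t]; ring
  rw [magGradSq_const_smul, Pi.smul_apply, norm_smul, mul_pow, mul_pow, Real.norm_eq_abs,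
    sq_abs, h4]
  ring

/-- If `s L + s² X / 2 ≥ R² E - C R` for all `s ≥ 0`, the choice `s = R √(-2E) / √X` bounds `L`
from below; for `X = 0` the bound follows by letting `s → ∞`. -/
lemma lower_bound_of_forall_scaling {R E C L X : ℝ} (hR : 0 < R) (hE : E < 0) (hX : 0 ≤ X)
    (h : ∀ s : ℝ, 0 ≤ s → R ^ 2 * E - C * R ≤ s * L + s ^ 2 / 2 * X) :
    (-R * √(-2 * E) - C * (√(-2 * E))⁻¹) * √X ≤ L := by
  rcases hX.eq_or_lt with rfl | hX
  · rw [Real.sqrt_zero, mul_zero]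
    by_contra! hL
    have hs := h ((|R ^ 2 * E - C * R| + 1) / -L) (by apply div_nonneg <;> [positivity; linarith])
    have hL0 : L ≠ 0 := hL.ne
    have hmul : (|R ^ 2 * E - C * R| + 1) / -L * L = -(|R ^ 2 * E - C * R| + 1) := by
      field_simp
    rw [hmul] at hs
    linarith [neg_abs_le (R ^ 2 * E - C * R)]
  · have hk : 0 < √(-2 * E) := Real.sqrt_pos.2 (by linarith)
    have hk2 : √(-2 * E) ^ 2 = -2 * E := Real.sq_sqrt (by linarith)
    have hq : 0 < √X := Real.sqrt_pos.2 hX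
    have hq2 : √X ^ 2 = X := Real.sq_sqrt hX.le
    generalize √(-2 * E) = k at hk hk2 ⊢
    generalize √X = q at hq hq2 ⊢
    subst hq2
    obtain rfl : E = -k ^ 2 / 2 := by linarith
    have hs := h (R * k / q) (by positivity)
    have hquad : (R * k / q) ^ 2 / 2 * q ^ 2 = R ^ 2 * k ^ 2 / 2 := by
      field_simp
    rw [hquad] at hs
    have hpos : 0 < R * k / q := by positivity
    refine le_of_mul_le_mul_left ?_ hpos
    have hmul : R * k / q * ((-R * k - C * k⁻¹) * q) = -(R ^ 2 * k ^ 2) - C * R := by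
      field_simp
    rw [hmul]
    linarith

/-- Lower bound of Theorem 1.1, Neumann case, pointwise form: if
`E_blk(·;b,R) ≥ R²E − C₀R` on `N_R` with `E < 0`, then
`E_lin(u;b,R) ≥ (−R√(−2E) − C₀(−2E)^{−1/2})·(∫|u|⁴)^{1/2}` for all `u ∈ N_R`, and
`m^N(b,R) ≥ −R√(−2E) − C₀(−2E)^{−1/2}`. -/
theorem neumann_lower_bound (b R E C₀ : ℝ) (hb : 0 < b) (hR : 0 < R) (hE : E < 0)
    (hC₀ : 0 ≤ C₀)
    (hlow : ∀ v : ℝ × ℝ → ℂ, NeumannClass v R → Eblk v b R ≥ R ^ 2 * E - C₀ * R) :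
    (∀ u : ℝ × ℝ → ℂ, NeumannClass u R →
      Elin u b R ≥ (-R * Real.sqrt (-2 * E) - C₀ * (Real.sqrt (-2 * E))⁻¹) *
        Real.sqrt (∫ x in QR R, ‖u x‖ ^ 4)) ∧
    mN b R ≥ -R * Real.sqrt (-2 * E) - C₀ * (Real.sqrt (-2 * E))⁻¹ := by
  have hpt : ∀ u : ℝ × ℝ → ℂ, NeumannClass u R →
      Elin u b R ≥ (-R * Real.sqrt (-2 * E) - C₀ * (Real.sqrt (-2 * E))⁻¹) *
        Real.sqrt (∫ x in QR R, ‖u x‖ ^ 4) := by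
    intro u hu
    refine lower_bound_of_forall_scaling hR hE (integral_nonneg fun x => by positivity) ?_
    intro s hs
    have h := hlow _ (hu.const_smul (√s))
    rwa [Eblk_const_smul hu, Real.sq_sqrt hs] at h
  refine ⟨hpt, le_csInf ⟨_, fun _ => 1, contDiffOn_const, ?_, rfl⟩ ?_⟩
  · exact fun h => one_ne_zero (congrFun h 0)
  · rintro m ⟨u, hu, -, rfl⟩
    rcases (Real.sqrt_nonneg (∫ x in QR R, ‖u x‖ ^ 4)).eq_or_lt with h0 | hpos
    · rw [← h0, div_zero, neg_mul, ← neg_add']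
      exact neg_nonpos.2 (by positivity)
    · exact (le_div_iff₀ hpos).2 (hpt u hu)
end
end

section
/- (Localization identity, equation (4.4) of the paper.) Let Ω ⊂ ℝ² be open, κ > 0, H > 0, A ∈ C¹(Ω; ℝ²), and let ψ ∈ C²(Ω; ℂ) satisfy −(∇ − iκHA)²ψ = κ²(1 − |ψ|²)ψ in Ω. Then for every real-valued f ∈ C_c^∞(Ω): ∫_Ω ( |(∇ − iκHA)(fψ)|² − κ²f²|ψ|² + (κ²/2)f⁴|ψ|⁴ ) dx = κ² ∫_Ω f²( (1/2)f² − 1 )|ψ|⁴ dx + ∫_Ω |∇f|²|ψ|² dx. -/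
open MeasureTheory

noncomputable section

/-- `|(∇ − icA)u|²`, the squared modulus of the magnetic gradient of `u` with
vector potential `A` and coupling `c` (here `c = κH`). -/
def magGradSqA (c : ℝ) (A : ℝ × ℝ → ℝ × ℝ) (u : ℝ × ℝ → ℂ) (x : ℝ × ℝ) : ℝ :=
  ‖fderiv ℝ u x (1, 0) - Complex.I * (c : ℂ) * ((A x).1 : ℂ) * u x‖ ^ 2 +
  ‖fderiv ℝ u x (0, 1) - Complex.I * (c : ℂ) * ((A x).2 : ℂ) * u x‖ ^ 2

/-- The divergence of a planar vector field. -/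
def divA (A : ℝ × ℝ → ℝ × ℝ) (x : ℝ × ℝ) : ℝ :=
  fderiv ℝ (fun y => (A y).1) x (1, 0) + fderiv ℝ (fun y => (A y).2) x (0, 1)

/-- The curl of a planar vector field, `curl A = ∂₁A₂ − ∂₂A₁`. -/
def curlA (A : ℝ × ℝ → ℝ × ℝ) (x : ℝ × ℝ) : ℝ :=
  fderiv ℝ (fun y => (A y).2) x (1, 0) - fderiv ℝ (fun y => (A y).1) x (0, 1)

/-- The Laplacian of `u : ℝ² → ℂ`. -/
def lap (u : ℝ × ℝ → ℂ) (x : ℝ × ℝ) : ℂ :=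
  fderiv ℝ (fun y => fderiv ℝ u y (1, 0)) x (1, 0) +
  fderiv ℝ (fun y => fderiv ℝ u y (0, 1)) x (0, 1)

/-- The magnetic Laplacian
`(∇ − icA)²u = Δu − 2ic A·∇u − ic(div A)u − c²|A|²u` (here `c = κH`). -/
def magLapA (c : ℝ) (A : ℝ × ℝ → ℝ × ℝ) (u : ℝ × ℝ → ℂ) (x : ℝ × ℝ) : ℂ :=
  lap u x
  - 2 * Complex.I * (c : ℂ) * (((A x).1 : ℂ) * fderiv ℝ u x (1, 0) +
                               ((A x).2 : ℂ) * fderiv ℝ u x (0, 1))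
  - Complex.I * (c : ℂ) * (divA A x : ℂ) * u x
  - ((c ^ 2 * ((A x).1 ^ 2 + (A x).2 ^ 2) : ℝ) : ℂ) * u x

/-- The first Ginzburg–Landau equation `−(∇ − iκHA)²ψ = κ²(1 − |ψ|²)ψ` on `Ω`. -/
def GLequation (κ H : ℝ) (A : ℝ × ℝ → ℝ × ℝ) (ψ : ℝ × ℝ → ℂ) (Ω : Set (ℝ × ℝ)) : Prop :=
  ∀ x ∈ Ω, -magLapA (κ * H) A ψ x = ((κ ^ 2 * (1 - ‖ψ x‖ ^ 2) : ℝ) : ℂ) * ψ x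

/-- The directional derivative of a compactly supported `C¹` function is integrable and has
integral zero. -/
theorem integrable_fderiv_apply_and_integral_eq_zero {V : ℝ × ℝ → ℝ} (hV : ContDiff ℝ 1 V)
    (hVc : HasCompactSupport V) (e : ℝ × ℝ) :
    Integrable (fun x => fderiv ℝ V x e) ∧ ∫ x, fderiv ℝ V x e = 0 := by
  have hint : Integrable (fun x => fderiv ℝ V x e) :=
    ((hV.continuous_fderiv one_ne_zero).clm_apply continuous_const).integrable_of_hasCompactSupport
      (hVc.fderiv_apply ℝ e)
  refine ⟨hint, ?_⟩
  simpa using integral_mul_fderiv_eq_neg_fderiv_mul_of_integrable (μ := volume)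
    (f := fun _ : ℝ × ℝ => (1 : ℝ)) (g := V) (v := e) (by simp) (by simpa using hint)
    (by simpa using hV.continuous.integrable_of_hasCompactSupport hVc)
    (fun _ _ => differentiableAt_const _) (fun x _ => hV.differentiable one_ne_zero x)

/-- A function continuous on a compact set and vanishing outside it is integrable. -/
theorem ContinuousOn.integrable_of_forall_notMem_eq_zero {g : ℝ × ℝ → ℝ} {K : Set (ℝ × ℝ)}
    (hg : ContinuousOn g K) (hK : IsCompact K) (h0 : ∀ x ∉ K, g x = 0) : Integrable g := by
  rw [← integrableOn_iff_integrable_of_support_subset (s := K)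
    (fun x hx => by_contra fun h => hx (h0 x h))]
  exact hg.integrableOn_compact hK

section LocalizedCurrent

variable {Ω : Set (ℝ × ℝ)} {ψ : ℝ × ℝ → ℂ} {f : ℝ × ℝ → ℝ}

/-- The component along `e` of `f² Re(ψ̄ ∇ψ)`. -/
def localizedCurrent (f : ℝ × ℝ → ℝ) (ψ : ℝ × ℝ → ℂ) (e x : ℝ × ℝ) : ℝ :=
  f x ^ 2 * inner ℝ (ψ x) (fderiv ℝ ψ x e)

theorem contDiffAt_fderiv_apply_of_contDiffOn (hΩ : IsOpen Ω) (hψ : ContDiffOn ℝ 2 ψ Ω)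
    (e : ℝ × ℝ) {x : ℝ × ℝ} (hx : x ∈ Ω) : ContDiffAt ℝ 1 (fun y => fderiv ℝ ψ y e) x :=
  ((hψ.contDiffAt (hΩ.mem_nhds hx)).fderiv_right (m := 1) (by norm_num)).clm_apply
    contDiffAt_const

theorem tsupport_localizedCurrent_subset (e : ℝ × ℝ) :
    tsupport (localizedCurrent f ψ e) ⊆ tsupport f := by
  refine closure_mono fun x hx h => hx ?_
  simp [localizedCurrent, h]

theorem contDiff_localizedCurrent (hΩ : IsOpen Ω) (hψ : ContDiffOn ℝ 2 ψ Ω)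
    (hf : ContDiff ℝ 1 f) (hfΩ : tsupport f ⊆ Ω) (e : ℝ × ℝ) :
    ContDiff ℝ 1 (localizedCurrent f ψ e) := by
  refine contDiff_iff_contDiffAt.2 fun x => ?_
  by_cases hx : x ∈ tsupport (localizedCurrent f ψ e)
  swap
  · exact contDiffAt_const.congr_of_eventuallyEq (notMem_tsupport_iff_eventuallyEq.1 hx)
  have hxΩ := hfΩ (tsupport_localizedCurrent_subset e hx)
  exact (hf.contDiffAt.pow 2).mul
    (((hψ.contDiffAt (hΩ.mem_nhds hxΩ)).of_le one_le_two).inner ℝ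
      (contDiffAt_fderiv_apply_of_contDiffOn hΩ hψ e hxΩ))

theorem fderiv_localizedCurrent_apply (hΩ : IsOpen Ω) (hψ : ContDiffOn ℝ 2 ψ Ω)
    (hf : Differentiable ℝ f) (e : ℝ × ℝ) {x : ℝ × ℝ} (hx : x ∈ Ω) :
    fderiv ℝ (localizedCurrent f ψ e) x e =
      2 * f x * fderiv ℝ f x e * inner ℝ (ψ x) (fderiv ℝ ψ x e)
      + f x ^ 2 * (‖fderiv ℝ ψ x e‖ ^ 2
        + inner ℝ (ψ x) (fderiv ℝ (fun y => fderiv ℝ ψ y e) x e)) := by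
  have h1 := ((hψ.contDiffAt (hΩ.mem_nhds hx)).differentiableAt two_ne_zero)
  have h2 := (contDiffAt_fderiv_apply_of_contDiffOn hΩ hψ e hx).differentiableAt one_ne_zero
  have h3 := ((hf x).hasFDerivAt.pow 2).mul (h1.hasFDerivAt.inner ℝ h2.hasFDerivAt)
  have h4 : fderiv ℝ (localizedCurrent f ψ e) x = _ := h3.fderiv
  rw [h4]
  simp [fderivInnerCLM_apply]
  ring

end LocalizedCurrent

theorem fderiv_ofReal_mul_apply {f : ℝ × ℝ → ℝ} {ψ : ℝ × ℝ → ℂ} {x : ℝ × ℝ}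
    (hf : DifferentiableAt ℝ f x) (hψ : DifferentiableAt ℝ ψ x) (e : ℝ × ℝ) :
    fderiv ℝ (fun y => (f y : ℂ) * ψ y) x e
      = (f x : ℂ) * fderiv ℝ ψ x e + (fderiv ℝ f x e : ℂ) * ψ x := by
  have h : (fun y => (f y : ℂ) * ψ y) = fun y => f y • ψ y := by
    ext y; simp
  rw [h, fderiv_fun_smul hf hψ]
  simp

/-- The pointwise form of the localization identity: the two integrands differ by the divergence
of the localized current. -/
theorem localization_integrand_eq {Ω : Set (ℝ × ℝ)} (hΩ : IsOpen Ω) {κ H : ℝ}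
    {A : ℝ × ℝ → ℝ × ℝ} {ψ : ℝ × ℝ → ℂ} (hψ : ContDiffOn ℝ 2 ψ Ω) (hGL : GLequation κ H A ψ Ω)
    {f : ℝ × ℝ → ℝ} (hf : Differentiable ℝ f) {x : ℝ × ℝ} (hx : x ∈ Ω) :
    magGradSqA (κ * H) A (fun y => (f y : ℂ) * ψ y) x
        - κ ^ 2 * f x ^ 2 * ‖ψ x‖ ^ 2 + κ ^ 2 / 2 * f x ^ 4 * ‖ψ x‖ ^ 4
    = (κ ^ 2 * (f x ^ 2 * ((1 / 2) * f x ^ 2 - 1) * ‖ψ x‖ ^ 4)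
      + ((fderiv ℝ f x (1, 0)) ^ 2 + (fderiv ℝ f x (0, 1)) ^ 2) * ‖ψ x‖ ^ 2)
      + (fderiv ℝ (localizedCurrent f ψ (1, 0)) x (1, 0)
        + fderiv ℝ (localizedCurrent f ψ (0, 1)) x (0, 1)) := by
  have hd := (hψ.contDiffAt (hΩ.mem_nhds hx)).differentiableAt two_ne_zero
  have hGLx := hGL x hx
  simp only [magGradSqA, fderiv_ofReal_mul_apply (hf x) hd,
    fderiv_localizedCurrent_apply hΩ hψ hf _ hx]
  simp only [magLapA, lap] at hGLx
  generalize κ * H = c at *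
  generalize fderiv ℝ (fun y => fderiv ℝ ψ y (1, 0)) x (1, 0) = ψ₁₁ at *
  generalize fderiv ℝ (fun y => fderiv ℝ ψ y (0, 1)) x (0, 1) = ψ₂₂ at *
  generalize fderiv ℝ ψ x (1, 0) = ψ₁ at *
  generalize fderiv ℝ ψ x (0, 1) = ψ₂ at *
  generalize fderiv ℝ f x (1, 0) = f₁ at *
  generalize fderiv ℝ f x (0, 1) = f₂ at *
  generalize divA A x = d at *
  generalize A x = a at *
  generalize ψ x = z at *
  generalize f x = t at *
  have h4 : ‖z‖ ^ 4 = (‖z‖ ^ 2) ^ 2 := by ring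
  have hre := congrArg Complex.re hGLx
  have him := congrArg Complex.im hGLx
  rw [h4]
  simp only [Complex.inner, Complex.sq_norm, Complex.normSq_apply] at hre him ⊢
  simp [-Complex.ofReal_pow] at hre him ⊢
  linear_combination (t ^ 2 * z.re) * hre + (t ^ 2 * z.im) * him

/-- Localization identity (equation (4.4) of the paper): for a critical point `ψ` of the
Ginzburg–Landau functional and a real cut-off `f ∈ C_c^∞(Ω)`,
`∫_Ω (|(∇−iκHA)(fψ)|² − κ²f²|ψ|² + (κ²/2)f⁴|ψ|⁴)
  = κ²∫_Ω f²(½f² − 1)|ψ|⁴ + ∫_Ω |∇f|²|ψ|²`. -/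
theorem localization_identity (Ω : Set (ℝ × ℝ)) (hΩ : IsOpen Ω) (κ H : ℝ)
    (hκ : 0 < κ) (hH : 0 < H) (A : ℝ × ℝ → ℝ × ℝ) (hA : ContDiffOn ℝ 1 A Ω)
    (ψ : ℝ × ℝ → ℂ) (hψ : ContDiffOn ℝ 2 ψ Ω) (hGL : GLequation κ H A ψ Ω)
    (f : ℝ × ℝ → ℝ) (hf : ContDiff ℝ (⊤ : ℕ∞) f) (hfc : HasCompactSupport f)
    (hfΩ : tsupport f ⊆ Ω) :
    (∫ x in Ω, (magGradSqA (κ * H) A (fun y => (f y : ℂ) * ψ y) x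
        - κ ^ 2 * f x ^ 2 * ‖ψ x‖ ^ 2 + κ ^ 2 / 2 * f x ^ 4 * ‖ψ x‖ ^ 4))
    = κ ^ 2 * (∫ x in Ω, f x ^ 2 * ((1 / 2) * f x ^ 2 - 1) * ‖ψ x‖ ^ 4)
      + ∫ x in Ω, ((fderiv ℝ f x (1, 0)) ^ 2 + (fderiv ℝ f x (0, 1)) ^ 2) * ‖ψ x‖ ^ 2 := by
  have hf1 : ContDiff ℝ 1 f := hf.of_le (by exact_mod_cast le_top)
  have hfd : Differentiable ℝ f := hf1.differentiable one_ne_zero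
  have hf' (e : ℝ × ℝ) : Continuous fun x => fderiv ℝ f x e :=
    (hf1.continuous_fderiv one_ne_zero).clm_apply continuous_const
  have hψK : ContinuousOn ψ (tsupport f) := hψ.continuousOn.mono hfΩ
  have hf0 {x : ℝ × ℝ} (hx : x ∉ tsupport f) : f x = 0 := image_eq_zero_of_notMem_tsupport hx
  have hf'0 {x : ℝ × ℝ} (hx : x ∉ tsupport f) : fderiv ℝ f x = 0 :=
    image_eq_zero_of_notMem_tsupport fun h => hx (tsupport_fderiv_subset ℝ h)
  have hquartic : Integrable fun x => f x ^ 2 * ((1 / 2) * f x ^ 2 - 1) * ‖ψ x‖ ^ 4 := by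
    refine ContinuousOn.integrable_of_forall_notMem_eq_zero (K := tsupport f) ?_ hfc
      fun x hx => by simp [hf0 hx]
    exact ContinuousOn.mul (by have := hf.continuous; fun_prop) (hψK.norm.pow 4)
  have hgrad : Integrable fun x =>
      ((fderiv ℝ f x (1, 0)) ^ 2 + (fderiv ℝ f x (0, 1)) ^ 2) * ‖ψ x‖ ^ 2 := by
    refine ContinuousOn.integrable_of_forall_notMem_eq_zero (K := tsupport f) ?_ hfc
      fun x hx => by simp [hf'0 hx]
    exact ContinuousOn.mul (((hf' _).pow 2).add ((hf' _).pow 2)).continuousOn (hψK.norm.pow 2)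
  have hcur (e : ℝ × ℝ) : Integrable (fun x => fderiv ℝ (localizedCurrent f ψ e) x e) ∧
      ∫ x in Ω, fderiv ℝ (localizedCurrent f ψ e) x e = 0 := by
    have h := integrable_fderiv_apply_and_integral_eq_zero
      (contDiff_localizedCurrent hΩ hψ hf1 hfΩ e)
      (hfc.of_isClosed_subset (isClosed_tsupport _) (tsupport_localizedCurrent_subset e)) e
    refine ⟨h.1, ?_⟩
    rw [setIntegral_eq_integral_of_forall_compl_eq_zero, h.2]
    intro x hx
    rw [image_eq_zero_of_notMem_tsupport (f := fderiv ℝ (localizedCurrent f ψ e)) fun h =>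
      hx (hfΩ (tsupport_localizedCurrent_subset e (tsupport_fderiv_subset ℝ h)))]
    rfl
  rw [setIntegral_congr_fun hΩ.measurableSet fun x hx =>
      localization_integrand_eq hΩ hψ hGL hfd hx,
    integral_add ((hquartic.const_mul _).fun_add hgrad).integrableOn
      ((hcur _).1.fun_add (hcur _).1).integrableOn,
    integral_add (hquartic.const_mul _).integrableOn hgrad.integrableOn,
    integral_add (hcur _).1.integrableOn (hcur _).1.integrableOn,
    (hcur _).2, (hcur _).2, integral_const_mul, add_zero, add_zero]
end
end

section
/- (Bound on the localized Ginzburg–Landau energy, equation (4.4) of the paper.) Let Ω ⊂ ℝ² be open, κ > 0, H > 0, M > 0, A ∈ C¹(Ω; ℝ²), and let ψ ∈ C²(Ω; ℂ) satisfy −(∇ − iκHA)²ψ = κ²(1 − |ψ|²)ψ in Ω together with |ψ(x)| ≤ 1 for all x ∈ Ω. Let f ∈ C_c^∞(Ω) be real-valued with 0 ≤ f ≤ 1, |∇f| ≤ M√κ everywhere, and with support contained in a square of side-length 4κ^{−1/2}. Then ∫_Ω ( |(∇ − iκHA)(fψ)|² − κ²f²|ψ|² + (κ²/2)f⁴|ψ|⁴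 ) dx ≤ 16M². -/
open MeasureTheory

noncomputable section

/-- The integral of a directional derivative of a compactly supported `C¹` function vanishes. -/
theorem integral_fderiv_apply_eq_zero {g : ℝ × ℝ → ℝ} (hg : ContDiff ℝ 1 g)
    (hc : HasCompactSupport g) (e : ℝ × ℝ) : ∫ x, fderiv ℝ g x e = 0 := by
  have h := integral_mul_fderiv_eq_neg_fderiv_mul_of_integrable (μ := (volume : Measure (ℝ × ℝ)))
    (f := fun _ => (1 : ℝ)) (g := g) (v := e) (by simp)
    (by simpa using ((hg.continuous_fderiv one_ne_zero).clm_apply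
      continuous_const).integrable_of_hasCompactSupport (hc.fderiv_apply ℝ e))
    (by simpa using hg.continuous.integrable_of_hasCompactSupport hc)
    (fun x _ => differentiableAt_const _) (fun x _ => (hg.differentiable one_ne_zero) x)
  simpa using h

/-- One directional component of the localization identity for the magnetic gradient. -/
theorem norm_sq_magnetic_fderiv_mul {f : ℝ × ℝ → ℝ} {ψ : ℝ × ℝ → ℂ} {x e : ℝ × ℝ} (b s : ℝ)
    (hf : DifferentiableAt ℝ f x) (hψ : DifferentiableAt ℝ ψ x)
    (hψ' : DifferentiableAt ℝ (fun y => fderiv ℝ ψ y e) x) :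
    ‖fderiv ℝ (fun y => (f y : ℂ) * ψ y) x e - Complex.I * b * ((f x : ℂ) * ψ x)‖ ^ 2 =
      fderiv ℝ (fun y => f y ^ 2 * inner ℝ (ψ y) (fderiv ℝ ψ y e)) x e
      + (fderiv ℝ f x e) ^ 2 * ‖ψ x‖ ^ 2
      - f x ^ 2 * inner ℝ (ψ x) (fderiv ℝ (fun y => fderiv ℝ ψ y e) x e
        - 2 * Complex.I * b * fderiv ℝ ψ x e - Complex.I * s * ψ x - (b : ℂ) ^ 2 * ψ x) := by
  have h₁ : fderiv ℝ (fun y => (f y : ℂ) * ψ y) x e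
      = (f x : ℂ) * fderiv ℝ ψ x e + (fderiv ℝ f x e : ℂ) * ψ x := by
    have := fderiv_fun_smul hf hψ
    simp only [Complex.real_smul] at this
    rw [this]
    simp
  have h₂ : fderiv ℝ (fun y => f y ^ 2 * inner ℝ (ψ y) (fderiv ℝ ψ y e)) x e
      = f x ^ 2 * (inner ℝ (ψ x) (fderiv ℝ (fun y => fderiv ℝ ψ y e) x e)
          + inner ℝ (fderiv ℝ ψ x e) (fderiv ℝ ψ x e))
        + inner ℝ (ψ x) (fderiv ℝ ψ x e) * (2 * f x * fderiv ℝ f x e) := by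
    rw [fderiv_fun_mul (hf.fun_pow 2) (hψ.inner ℝ hψ')]
    simp only [add_apply, smul_apply, smul_eq_mul,
      fderiv_inner_apply ℝ hψ hψ', fderiv_fun_pow 2 hf]
    simp
  rw [h₁, h₂]
  simp only [Complex.inner, ← Complex.normSq_eq_norm_sq, Complex.normSq_apply]
  simp [pow_two]
  ring

/-- The field `f² Re(ψ̄ ∂ₑψ)`, extended by zero outside the support of `f`, is `C¹`. -/
theorem contDiff_sq_mul_inner_fderiv {Ω : Set (ℝ × ℝ)} (hΩ : IsOpen Ω) {f : ℝ × ℝ → ℝ}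
    {ψ : ℝ × ℝ → ℂ} (hψ : ContDiffOn ℝ 2 ψ Ω) (hf : ContDiff ℝ 1 f) (hfΩ : tsupport f ⊆ Ω)
    (e : ℝ × ℝ) : ContDiff ℝ 1 (fun y => f y ^ 2 * inner ℝ (ψ y) (fderiv ℝ ψ y e)) := by
  rw [contDiff_iff_contDiffAt]
  intro x
  by_cases hx : x ∈ tsupport f
  · have hψx : ContDiffAt ℝ 2 ψ x := hψ.contDiffAt (hΩ.mem_nhds (hfΩ hx))
    exact (hf.contDiffAt.pow 2).mul ((hψx.of_le one_le_two).inner ℝ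
      ((hψx.fderiv_right (m := 1) (by norm_num)).clm_apply contDiffAt_const))
  · have h0 : f =ᶠ[nhds x] 0 := notMem_tsupport_iff_eventuallyEq.mp hx
    refine (contDiffAt_const (c := (0 : ℝ))).congr_of_eventuallyEq ?_
    filter_upwards [h0] with y hy
    simp [hy]

/-- Bound on the localized Ginzburg–Landau energy (equation (4.4) of the paper): for a
critical point `ψ` with `|ψ| ≤ 1` and a cut-off `0 ≤ f ≤ 1` with `|∇f| ≤ M√κ` supported
in a square of side-length `4κ^{−1/2}`, the localized energy is at most `16M²`. -/
theorem localized_energy_bound (Ω : Set (ℝ × ℝ)) (hΩ : IsOpen Ω) (κ H M : ℝ)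
    (hκ : 0 < κ) (hH : 0 < H) (hM : 0 < M) (A : ℝ × ℝ → ℝ × ℝ) (hA : ContDiffOn ℝ 1 A Ω)
    (ψ : ℝ × ℝ → ℂ) (hψ : ContDiffOn ℝ 2 ψ Ω) (hGL : GLequation κ H A ψ Ω)
    (hψ1 : ∀ x ∈ Ω, ‖ψ x‖ ≤ 1)
    (f : ℝ × ℝ → ℝ) (hf : ContDiff ℝ (⊤ : ℕ∞) f) (hfc : HasCompactSupport f)
    (hfΩ : tsupport f ⊆ Ω) (hf0 : ∀ x, 0 ≤ f x) (hf1 : ∀ x, f x ≤ 1)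
    (hgradf : ∀ x, Real.sqrt ((fderiv ℝ f x (1, 0)) ^ 2 + (fderiv ℝ f x (0, 1)) ^ 2)
      ≤ M * Real.sqrt κ)
    (hsupp : ∃ c : ℝ × ℝ, tsupport f ⊆
      Set.Icc (c.1 - 2 * (Real.sqrt κ)⁻¹) (c.1 + 2 * (Real.sqrt κ)⁻¹) ×ˢ
      Set.Icc (c.2 - 2 * (Real.sqrt κ)⁻¹) (c.2 + 2 * (Real.sqrt κ)⁻¹)) :
    (∫ x in Ω, (magGradSqA (κ * H) A (fun y => (f y : ℂ) * ψ y) x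
        - κ ^ 2 * f x ^ 2 * ‖ψ x‖ ^ 2 + κ ^ 2 / 2 * f x ^ 4 * ‖ψ x‖ ^ 4))
    ≤ 16 * M ^ 2 := by
  obtain ⟨c, hc⟩ := hsupp
  have hf' : ContDiff ℝ 1 f := hf.of_le (by exact_mod_cast le_top)
  set K : Set (ℝ × ℝ) := Set.Icc (c.1 - 2 * (Real.sqrt κ)⁻¹) (c.1 + 2 * (Real.sqrt κ)⁻¹) ×ˢ
      Set.Icc (c.2 - 2 * (Real.sqrt κ)⁻¹) (c.2 + 2 * (Real.sqrt κ)⁻¹) with hK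
  have hKm : MeasurableSet K := measurableSet_Icc.prod measurableSet_Icc
  have hKvol : volume.real K = 16 / κ := by
    have hs : 0 < Real.sqrt κ := Real.sqrt_pos.mpr hκ
    have hi : 0 < (Real.sqrt κ)⁻¹ := inv_pos.mpr hs
    rw [hK, Measure.volume_eq_prod, measureReal_prod_prod, Real.volume_real_Icc_of_le (by linarith),
      Real.volume_real_Icc_of_le (by linarith)]
    have : (Real.sqrt κ)⁻¹ * (Real.sqrt κ)⁻¹ = κ⁻¹ := by
      rw [← mul_inv, Real.mul_self_sqrt hκ.le]
    rw [div_eq_mul_inv, ← this]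
    ring
  have hKfin : volume K ≠ ⊤ :=
    ((isCompact_Icc.prod isCompact_Icc).measure_lt_top).ne
  let V : ℝ × ℝ → ℝ × ℝ → ℝ := fun e y => f y ^ 2 * inner ℝ (ψ y) (fderiv ℝ ψ y e)
  have hV : ∀ e, ContDiff ℝ 1 (V e) := contDiff_sq_mul_inner_fderiv hΩ hψ hf' hfΩ
  have hVsupp : ∀ e, Function.support (V e) ⊆ tsupport f := fun e y hy =>
    subset_tsupport f fun h => hy (by simp [V, h])
  have hVc : ∀ e, HasCompactSupport (V e) := fun e => hfc.mono' (hVsupp e)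
  have hVint : ∀ e, Integrable (fun x => fderiv ℝ (V e) x e) := fun e =>
    (((hV e).continuous_fderiv one_ne_zero).clm_apply
      continuous_const).integrable_of_hasCompactSupport ((hVc e).fderiv_apply ℝ e)
  have hVΩ : ∀ e, ∫ x in Ω, fderiv ℝ (V e) x e = 0 := by
    intro e
    rw [setIntegral_eq_integral_of_forall_compl_eq_zero,
      integral_fderiv_apply_eq_zero (hV e) (hVc e)]
    intro x hx
    rw [fderiv_of_notMem_tsupport ℝ fun h =>
      hx (hfΩ (closure_minimal (hVsupp e) (isClosed_tsupport f) h))]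
    simp
  have hKint : Integrable (K.indicator fun _ => M ^ 2 * κ) :=
    (integrable_indicator_iff hKm).mpr (integrableOn_const hKfin)
  have hpoint : ∀ x ∈ Ω, magGradSqA (κ * H) A (fun y => (f y : ℂ) * ψ y) x
        - κ ^ 2 * f x ^ 2 * ‖ψ x‖ ^ 2 + κ ^ 2 / 2 * f x ^ 4 * ‖ψ x‖ ^ 4
      ≤ fderiv ℝ (V (1, 0)) x (1, 0) + fderiv ℝ (V (0, 1)) x (0, 1)
        + K.indicator (fun _ => M ^ 2 * κ) x := by
    intro x hx
    have hψx : ContDiffAt ℝ 2 ψ x := hψ.contDiffAt (hΩ.mem_nhds hx)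
    have hfx : DifferentiableAt ℝ f x := hf'.differentiable one_ne_zero x
    have hψd : DifferentiableAt ℝ ψ x := hψx.differentiableAt two_ne_zero
    have hψ' : ∀ e, DifferentiableAt ℝ (fun y => fderiv ℝ ψ y e) x := fun e =>
      ((hψx.fderiv_right (m := 1) (by norm_num)).clm_apply
        contDiffAt_const).differentiableAt one_ne_zero
    have h₁ := norm_sq_magnetic_fderiv_mul (κ * H * (A x).1)
      (κ * H * fderiv ℝ (fun y => (A y).1) x (1, 0)) hfx hψd (hψ' (1, 0))
    have h₂ := norm_sq_magnetic_fderiv_mul (κ * H * (A x).2)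
      (κ * H * fderiv ℝ (fun y => (A y).2) x (0, 1)) hfx hψd (hψ' (0, 1))
    have hmag : inner ℝ (ψ x) (magLapA (κ * H) A ψ x)
        = -(κ ^ 2 * (1 - ‖ψ x‖ ^ 2)) * ‖ψ x‖ ^ 2 := by
      rw [← neg_neg (magLapA _ _ _ _), hGL x hx, inner_neg_right, ← Complex.real_smul,
        real_inner_smul_right, real_inner_self_eq_norm_sq]
      ring
    have hgrad : ((fderiv ℝ f x (1, 0)) ^ 2 + (fderiv ℝ f x (0, 1)) ^ 2) * ‖ψ x‖ ^ 2
        ≤ K.indicator (fun _ => M ^ 2 * κ) x := by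
      by_cases hxK : x ∈ K
      · rw [Set.indicator_of_mem hxK]
        have hg := (Real.sqrt_le_left (by positivity)).mp (hgradf x)
        rw [mul_pow, Real.sq_sqrt hκ.le] at hg
        have hn : ‖ψ x‖ ^ 2 ≤ 1 := pow_le_one₀ (norm_nonneg _) (hψ1 x hx)
        exact (mul_le_of_le_one_right (by positivity) hn).trans hg
      · rw [Set.indicator_of_notMem hxK, fderiv_of_notMem_tsupport ℝ fun h => hxK (hc h)]
        simp
    have hf4 : f x ^ 4 ≤ f x ^ 2 := pow_le_pow_of_le_one (hf0 x) (hf1 x) (by norm_num)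
    have hquart : κ ^ 2 * ‖ψ x‖ ^ 4 * f x ^ 4 ≤ κ ^ 2 * ‖ψ x‖ ^ 4 * f x ^ 2 :=
      mul_le_mul_of_nonneg_left hf4 (by positivity)
    have hpos : 0 ≤ κ ^ 2 * ‖ψ x‖ ^ 4 * f x ^ 4 := by positivity
    have hsum : magGradSqA (κ * H) A (fun y => (f y : ℂ) * ψ y) x
        = fderiv ℝ (V (1, 0)) x (1, 0) + fderiv ℝ (V (0, 1)) x (0, 1)
          + ((fderiv ℝ f x (1, 0)) ^ 2 + (fderiv ℝ f x (0, 1)) ^ 2) * ‖ψ x‖ ^ 2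
          - f x ^ 2 * inner ℝ (ψ x) (magLapA (κ * H) A ψ x) := by
      have hsplit : magLapA (κ * H) A ψ x =
          (fderiv ℝ (fun y => fderiv ℝ ψ y (1, 0)) x (1, 0)
            - 2 * Complex.I * (κ * H * (A x).1 : ℝ) * fderiv ℝ ψ x (1, 0)
            - Complex.I * (κ * H * fderiv ℝ (fun y => (A y).1) x (1, 0) : ℝ) * ψ x
            - ((κ * H * (A x).1 : ℝ) : ℂ) ^ 2 * ψ x)
          + (fderiv ℝ (fun y => fderiv ℝ ψ y (0, 1)) x (0, 1)
            - 2 * Complex.I * (κ * H * (A x).2 : ℝ) * fderiv ℝ ψ x (0, 1)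
            - Complex.I * (κ * H * fderiv ℝ (fun y => (A y).2) x (0, 1) : ℝ) * ψ x
            - ((κ * H * (A x).2 : ℝ) : ℂ) ^ 2 * ψ x) := by
        simp only [magLapA, lap, divA]
        push_cast
        ring
      rw [hsplit, inner_add_right]
      have hgauge : ∀ a : ℝ, Complex.I * ((κ * H : ℝ) : ℂ) * (a : ℂ) * ((f x : ℂ) * ψ x)
          = Complex.I * ((κ * H * a : ℝ) : ℂ) * ((f x : ℂ) * ψ x) := fun a => by
        push_cast
        ring
      rw [magGradSqA, hgauge, hgauge, h₁, h₂]
      ring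
    rw [hsum, hmag]
    linarith
  by_cases hint : IntegrableOn (fun x => magGradSqA (κ * H) A (fun y => (f y : ℂ) * ψ y) x
        - κ ^ 2 * f x ^ 2 * ‖ψ x‖ ^ 2 + κ ^ 2 / 2 * f x ^ 4 * ‖ψ x‖ ^ 4) Ω
  · have hd : IntegrableOn (fun x => fderiv ℝ (V (1, 0)) x (1, 0)
        + fderiv ℝ (V (0, 1)) x (0, 1)) Ω :=
      ((hVint (1, 0)).add (hVint (0, 1))).integrableOn (s := Ω)
    refine (setIntegral_mono_on hint (hd.add hKint.integrableOn) hΩ.measurableSet hpoint).trans ?_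
    have hsplit : ∫ x in Ω, (fderiv ℝ (V (1, 0)) x (1, 0) + fderiv ℝ (V (0, 1)) x (0, 1)
        + K.indicator (fun _ => M ^ 2 * κ) x) = ∫ x in Ω, K.indicator (fun _ => M ^ 2 * κ) x := by
      rw [integral_add hd hKint.integrableOn, integral_add (hVint (1, 0)).integrableOn
        (hVint (0, 1)).integrableOn, hVΩ, hVΩ, add_zero, zero_add]
    refine hsplit.trans_le ((setIntegral_le_integral hKint
      (Filter.Eventually.of_forall fun x => Set.indicator_nonneg
        (fun _ _ => by positivity) x)).trans (le_of_eq ?_))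
    rw [integral_indicator hKm, setIntegral_const, hKvol, smul_eq_mul]
    field_simp
  · rw [integral_undef hint]
    positivity
end
end

section
/- (Lemma 4.3: quantitative gauge transformation.) There exists a universal constant C > 0 such that the following holds. Let x₀ ∈ ℝ², r > 0, δ ≥ 0, and let A be a C² vector field on an open neighborhood of the closed disk of center x₀ and radius r, satisfying |∂₁A₂(x) − ∂₂A₁(x) − 1| ≤ δ for every x in that closed disk. Then there exists a real-valued function φ, C² on the open disk B(x₀, r), such that |A(x) − A₀(x) + ∇φ(x)| ≤ Cδr for every x ∈ B(x₀, r), where A₀ is the vector potential A₀(x₁,x₂) = (−x₂/2, x₁/2). -/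
open MeasureTheory

noncomputable section

/-- The closed disk of center `c` and radius `r` (Euclidean). -/
def closedDisk (c : ℝ × ℝ) (r : ℝ) : Set (ℝ × ℝ) :=
  {x : ℝ × ℝ | (x.1 - c.1) ^ 2 + (x.2 - c.2) ^ 2 ≤ r ^ 2}

/-- The open disk of center `c` and radius `r` (Euclidean). -/
def openDisk (c : ℝ × ℝ) (r : ℝ) : Set (ℝ × ℝ) :=
  {x : ℝ × ℝ | (x.1 - c.1) ^ 2 + (x.2 - c.2) ^ 2 < r ^ 2}

open Topology in
/-- A `Cⁿ` map on an open set `U` agrees near a closed subset of `U` with a globally `Cⁿ` map. -/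
theorem exists_contDiff_eventuallyEq_nhdsSet {E F : Type*} [NormedAddCommGroup E]
    [NormedSpace ℝ E] [FiniteDimensional ℝ E] [NormedAddCommGroup F] [NormedSpace ℝ F]
    {n : ℕ} {f : E → F} {K U : Set E} (hK : IsClosed K) (hU : IsOpen U) (hKU : K ⊆ U)
    (hf : ContDiffOn ℝ n f U) :
    ∃ g : E → F, ContDiff ℝ n g ∧ ∀ᶠ x in 𝓝ˢ K, g x = f x := by
  obtain ⟨χ, hχ0, hχ1, -⟩ := exists_contMDiffMap_zero_one_nhds_of_isClosed (n := n)
    (modelWithCornersSelf ℝ E) hU.isClosed_compl hK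
    (Set.disjoint_compl_left_iff_subset.2 hKU)
  have hχ : ContDiff ℝ n χ := χ.contMDiff.contDiff
  refine ⟨fun x => χ x • f x, contDiff_iff_contDiffAt.2 fun x => ?_, ?_⟩
  · by_cases hx : x ∈ U
    · exact hχ.contDiffAt.smul (hf.contDiffAt (hU.mem_nhds hx))
    · refine (contDiffAt_const (c := (0 : F))).congr_of_eventuallyEq ?_
      filter_upwards [Filter.Eventually.filter_mono (nhds_le_nhdsSet hx) hχ0] with y hy
      simp [hy]
  · filter_upwards [hχ1] with x hx
    simp [hx]

section ParametricIntegral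

universe u

variable {E F : Type u} [NormedAddCommGroup E] [NormedSpace ℝ E]
  [NormedAddCommGroup F] [NormedSpace ℝ F]

theorem continuous_fderiv_of_contDiff_uncurry {f : E → ℝ → F}
    (hf : ContDiff ℝ 1 (Function.uncurry f)) :
    Continuous fun p : E × ℝ => fderiv ℝ (fun y => f y p.2) p.1 :=
  (ContDiff.fderiv (n := 0) (f := fun (p : E × ℝ) y => f y p.2) (g := Prod.fst) (m := 1)
    (hf.comp (contDiff_snd.prodMk (contDiff_snd.comp contDiff_fst))) contDiff_fst
    (by simp)).continuous

variable [FiniteDimensional ℝ E]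

/-- Differentiation under the integral sign for a jointly `C¹` integrand. -/
theorem hasFDerivAt_intervalIntegral_of_contDiff {f : E → ℝ → F}
    (hf : ContDiff ℝ 1 (Function.uncurry f)) (a b : ℝ) (x : E) :
    HasFDerivAt (fun x => ∫ t in a..b, f x t)
      (∫ t in a..b, fderiv ℝ (fun y => f y t) x) x := by
  have hf' := continuous_fderiv_of_contDiff_uncurry hf
  obtain ⟨M, hM⟩ := ((isCompact_closedBall x 1).prod
    (isCompact_uIcc (a := a) (b := b))).exists_bound_of_continuousOn hf'.continuousOn
  refine intervalIntegral.hasFDerivAt_integral_of_dominated_of_fderiv_le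
    (F' := fun y t => fderiv ℝ (fun z => f z t) y) (bound := fun _ => M)
    (Metric.closedBall_mem_nhds x one_pos) ?_ ?_ ?_ ?_ ?_ ?_
  · exact Filter.Eventually.of_forall fun y =>
      (hf.continuous.comp (Continuous.prodMk_right y)).aestronglyMeasurable
  · exact (hf.continuous.comp (Continuous.prodMk_right x)).intervalIntegrable a b
  · exact (hf'.comp (Continuous.prodMk_right x)).aestronglyMeasurable
  · exact Filter.Eventually.of_forall fun t ht y hy =>
      hM (y, t) ⟨hy, Set.uIoc_subset_uIcc ht⟩
  · exact intervalIntegrable_const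
  · refine Filter.Eventually.of_forall fun t _ y _ => ?_
    exact ((hf.differentiable one_ne_zero).comp
      (differentiable_id.prodMk (differentiable_const t)) y).hasFDerivAt

/-- An integral depending on a parameter is `Cⁿ` if the integrand is jointly `Cⁿ`. -/
theorem contDiff_intervalIntegral_of_contDiff {n : ℕ} {f : E → ℝ → F}
    (hf : ContDiff ℝ n (Function.uncurry f)) (a b : ℝ) :
    ContDiff ℝ n fun x => ∫ t in a..b, f x t := by
  induction n generalizing F with
  | zero =>
    exact contDiff_zero.2
      (intervalIntegral.continuous_parametric_intervalIntegral_of_continuous' hf.continuous a b)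
  | succ n ih =>
    refine contDiff_succ_iff_hasFDerivAt.2 ⟨_, ih ?_, fun x =>
      hasFDerivAt_intervalIntegral_of_contDiff (hf.of_le (by simp)) a b x⟩
    exact ContDiff.fderiv (f := fun (p : E × ℝ) y => f y p.2) (g := Prod.fst)
      (hf.comp (contDiff_snd.prodMk (contDiff_snd.comp contDiff_fst))) contDiff_fst
      (by simp)

end ParametricIntegral

/-- The radial (Poincaré) gauge: up to an exact form, a one-form `ω` is the radial average of
the contraction of `dω` with the position vector. -/
theorem exists_radial_gauge {E : Type} [NormedAddCommGroup E] [NormedSpace ℝ E]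
    [FiniteDimensional ℝ E] {n : ℕ} (hn : n ≠ 0) {ω : E → E →L[ℝ] ℝ} (hω : ContDiff ℝ n ω)
    (c : E) :
    ∃ φ : E → ℝ, ContDiff ℝ n φ ∧ ∀ x v, ω x v + fderiv ℝ φ x v =
      ∫ t in (0 : ℝ)..1, t * (fderiv ℝ ω (c + t • (x - c)) (x - c) v
        - fderiv ℝ ω (c + t • (x - c)) v (x - c)) := by
  set f : E → ℝ → ℝ := fun y t => ω (c + t • (y - c)) (y - c)
  have hf : ContDiff ℝ n (Function.uncurry f) := by
    change ContDiff ℝ n fun p : E × ℝ => ω (c + p.2 • (p.1 - c)) (p.1 - c)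
    fun_prop
  have h1n : (1 : WithTop ℕ∞) ≤ n := by exact_mod_cast Nat.one_le_iff_ne_zero.2 hn
  have hω1 : ContDiff ℝ 1 ω := hω.of_le h1n
  have hdω : Continuous (fderiv ℝ ω) := hω1.continuous_fderiv one_ne_zero
  have hωd : ∀ z, HasFDerivAt ω (fderiv ℝ ω z) z := fun z =>
    (hω1.differentiable one_ne_zero z).hasFDerivAt
  have hωc : Continuous ω := hω1.continuous
  refine ⟨fun x => -∫ t in (0 : ℝ)..1, f x t,
    (contDiff_intervalIntegral_of_contDiff hf 0 1).neg, fun x v => ?_⟩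
  have hfx : ∀ t, HasFDerivAt (fun y => f y t)
      ((ω (c + t • (x - c))).comp (ContinuousLinearMap.id ℝ E) +
        ((fderiv ℝ ω (c + t • (x - c))).comp (t • ContinuousLinearMap.id ℝ E)).flip (x - c))
      x := fun t =>
    ((hωd (c + t • (x - c))).comp x ((((hasFDerivAt_id x).sub_const c).const_smul t).const_add
      c)).clm_apply ((hasFDerivAt_id x).sub_const c)
  have hφ : fderiv ℝ (fun x => -∫ t in (0 : ℝ)..1, f x t) x v =
      -∫ t in (0 : ℝ)..1, (ω (c + t • (x - c)) v
        + t * fderiv ℝ ω (c + t • (x - c)) v (x - c)) := by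
    rw [(hasFDerivAt_intervalIntegral_of_contDiff (hf.of_le h1n) 0 1 x).fun_neg.fderiv,
      neg_apply, ContinuousLinearMap.intervalIntegral_apply]
    · simp [(hfx _).fderiv]
    · exact ((continuous_fderiv_of_contDiff_uncurry (hf.of_le h1n)).comp
        (Continuous.prodMk_right x)).intervalIntegrable 0 1
  have hFTC : ω x v = ∫ t in (0 : ℝ)..1, (ω (c + t • (x - c)) v
        + t * fderiv ℝ ω (c + t • (x - c)) (x - c) v) := by
    have hd : ∀ t : ℝ, HasDerivAt (fun t : ℝ => t * ω (c + t • (x - c)) v)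
        (ω (c + t • (x - c)) v + t * fderiv ℝ ω (c + t • (x - c)) (x - c) v) t := fun t => by
      have hline : HasDerivAt (fun t : ℝ => c + t • (x - c)) (x - c) t := by
        simpa using ((hasDerivAt_id t).smul_const (x - c)).const_add c
      have h : HasDerivAt (fun t : ℝ => ω (c + t • (x - c)) v)
          (fderiv ℝ ω (c + t • (x - c)) (x - c) v) t :=
        (ContinuousLinearMap.apply ℝ ℝ v).hasFDerivAt.comp_hasDerivAt t
          ((hωd (c + t • (x - c))).comp_hasDerivAt t hline)
      convert! (hasDerivAt_id t).mul h using 1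
      simp
    rw [intervalIntegral.integral_eq_sub_of_hasDerivAt (fun t _ => hd t)]
    · simp
    · apply Continuous.intervalIntegrable
      fun_prop
  rw [hφ, hFTC, ← sub_eq_add_neg, ← intervalIntegral.integral_sub]
  · congr 1 with t
    ring
  all_goals
    apply Continuous.intervalIntegrable
    fun_prop

/-- The radial gauge for a planar vector field. -/
theorem exists_radial_gauge_curlA {n : ℕ} (hn : n ≠ 0) {B : ℝ × ℝ → ℝ × ℝ} (hB : ContDiff ℝ n B)
    (c : ℝ × ℝ) :
    ∃ φ : ℝ × ℝ → ℝ, ContDiff ℝ n φ ∧ ∀ x,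
      (B x).1 + fderiv ℝ φ x (1, 0) =
        -(x.2 - c.2) * ∫ t in (0 : ℝ)..1, t * curlA B (c + t • (x - c)) ∧
      (B x).2 + fderiv ℝ φ x (0, 1) =
        (x.1 - c.1) * ∫ t in (0 : ℝ)..1, t * curlA B (c + t • (x - c)) := by
  set ω : ℝ × ℝ → ℝ × ℝ →L[ℝ] ℝ := fun x =>
    (B x).1 • ContinuousLinearMap.fst ℝ ℝ ℝ + (B x).2 • ContinuousLinearMap.snd ℝ ℝ ℝ with hω_def
  have hω : ContDiff ℝ n ω := by fun_prop
  have hB' : Differentiable ℝ B := hB.differentiable (by exact_mod_cast hn)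
  have hdω : ∀ z u v, fderiv ℝ ω z u v =
      fderiv ℝ (fun y => (B y).1) z u * v.1 + fderiv ℝ (fun y => (B y).2) z u * v.2 := by
    intro z u v
    have h := ((hB' z).fst.hasFDerivAt.smul_const (ContinuousLinearMap.fst ℝ ℝ ℝ)).add
      ((hB' z).snd.hasFDerivAt.smul_const (ContinuousLinearMap.snd ℝ ℝ ℝ))
    rw [show fderiv ℝ ω z = _ from h.fderiv]
    simp
  obtain ⟨φ, hφ, hφω⟩ := exists_radial_gauge hn hω c
  refine ⟨φ, hφ, fun x => ?_⟩
  have hlin : ∀ L : ℝ × ℝ →L[ℝ] ℝ,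
      L (x - c) = (x.1 - c.1) * L (1, 0) + (x.2 - c.2) * L (0, 1) := fun L => by
    rw [← smul_eq_mul, ← smul_eq_mul, ← map_smul, ← map_smul, ← map_add]
    congr 1
    ext <;> simp
  have h1 := hφω x (1, 0)
  have h2 := hφω x (0, 1)
  simp only [hdω, hlin (fderiv ℝ _ _)] at h1 h2
  simp only [← intervalIntegral.integral_const_mul, curlA]
  constructor
  · convert! h1 using 1
    · simp [hω_def]
    · congr 1 with t
      simp
      ring
  · convert! h2 using 1
    · simp [hω_def]
    · congr 1 with t
      simp
      ring

/-- The field `A0` has unit curl. -/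
theorem curlA_sub_A0 {A : ℝ × ℝ → ℝ × ℝ} {x : ℝ × ℝ} (hA : DifferentiableAt ℝ A x) :
    curlA (fun y => A y - A0 y) x = curlA A x - 1 := by
  have h1 := hA.fst.hasFDerivAt.sub
    (((hasFDerivAt_snd (𝕜 := ℝ) (p := x)).neg).mul_const (2⁻¹ : ℝ))
  have h2 := hA.snd.hasFDerivAt.sub ((hasFDerivAt_fst (𝕜 := ℝ) (p := x)).mul_const (2⁻¹ : ℝ))
  simp only [curlA]
  rw [show fderiv ℝ (fun y => (A y - A0 y).2) x = _ from h2.fderiv,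
    show fderiv ℝ (fun y => (A y - A0 y).1) x = _ from h1.fderiv]
  simp
  ring

theorem Filter.EventuallyEq.curlA_eq {A B : ℝ × ℝ → ℝ × ℝ} {x : ℝ × ℝ}
    (h : A =ᶠ[nhds x] B) : curlA A x = curlA B x := by
  have h1 : fderiv ℝ (fun y => (A y).1) x = fderiv ℝ (fun y => (B y).1) x :=
    (h.fun_comp Prod.fst).fderiv_eq
  have h2 : fderiv ℝ (fun y => (A y).2) x = fderiv ℝ (fun y => (B y).2) x :=
    (h.fun_comp Prod.snd).fderiv_eq
  rw [curlA, curlA, h1, h2]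

theorem isClosed_closedDisk (c : ℝ × ℝ) (r : ℝ) : IsClosed (closedDisk c r) :=
  isClosed_le (by fun_prop) continuous_const

theorem add_smul_sub_mem_closedDisk {c x : ℝ × ℝ} {r t : ℝ} (hx : x ∈ closedDisk c r)
    (ht0 : 0 ≤ t) (ht1 : t ≤ 1) : c + t • (x - c) ∈ closedDisk c r := by
  simp only [closedDisk, Set.mem_ofPred_eq, Prod.fst_add, Prod.snd_add, Prod.smul_fst,
    Prod.smul_snd, Prod.fst_sub, Prod.snd_sub, smul_eq_mul, add_sub_cancel_left] at hx ⊢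
  nlinarith [pow_le_one₀ ht0 ht1 (n := 2), sq_nonneg (x.1 - c.1), sq_nonneg (x.2 - c.2)]

/-- Lemma 4.3: quantitative gauge transformation. There is a universal constant `C > 0`
such that if `A` is `C²` on an open neighborhood of the closed disk `B̄(x₀,r)` with
`|curl A − 1| ≤ δ` there, then there is a real `C²` function `φ` on `B(x₀,r)` with
`|A − A₀ + ∇φ| ≤ Cδr` on `B(x₀,r)`. -/
theorem gauge_transformation :
    ∃ C : ℝ, 0 < C ∧ ∀ (x₀ : ℝ × ℝ) (r δ : ℝ) (A : ℝ × ℝ → ℝ × ℝ) (U : Set (ℝ × ℝ)),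
      0 < r → 0 ≤ δ → IsOpen U → closedDisk x₀ r ⊆ U → ContDiffOn ℝ 2 A U →
      (∀ x ∈ closedDisk x₀ r, |curlA A x - 1| ≤ δ) →
      ∃ φ : ℝ × ℝ → ℝ, ContDiffOn ℝ 2 φ (openDisk x₀ r) ∧
        ∀ x ∈ openDisk x₀ r,
          Real.sqrt (((A x).1 - (A0 x).1 + fderiv ℝ φ x (1, 0)) ^ 2 +
                     ((A x).2 - (A0 x).2 + fderiv ℝ φ x (0, 1)) ^ 2) ≤ C * δ * r := by
  refine ⟨1, one_pos, fun c r δ A U hr hδ hU hcU hA hcurl => ?_⟩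
  obtain ⟨A', hA', hAA'⟩ := exists_contDiff_eventuallyEq_nhdsSet (n := 2)
    (isClosed_closedDisk c r) hU hcU hA
  have hA0 : ContDiff ℝ 2 A0 := by
    unfold A0
    fun_prop
  obtain ⟨φ, hφ, hφA⟩ := exists_radial_gauge_curlA two_ne_zero (B := fun y => A' y - A0 y)
    (hA'.sub hA0) c
  refine ⟨φ, hφ.contDiffOn, fun x hx => ?_⟩
  have hxc : x ∈ closedDisk c r := by
    simp only [openDisk, closedDisk, Set.mem_ofPred_eq] at hx ⊢
    exact hx.le
  have hint : |∫ t in (0 : ℝ)..1, t * curlA (fun y => A' y - A0 y) (c + t • (x - c))| ≤ δ := by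
    have h := intervalIntegral.norm_integral_le_of_norm_le_const (a := (0 : ℝ)) (b := 1) (C := δ)
      (f := fun t => t * curlA (fun y => A' y - A0 y) (c + t • (x - c))) fun t ht => by
        rw [Set.uIoc_of_le zero_le_one] at ht
        have hz := add_smul_sub_mem_closedDisk hxc ht.1.le ht.2
        rw [curlA_sub_A0 (hA'.differentiable two_ne_zero _),
          Filter.EventuallyEq.curlA_eq (hAA'.filter_mono (nhds_le_nhdsSet hz)), norm_mul,
          Real.norm_of_nonneg ht.1.le, Real.norm_eq_abs]
        exact (mul_le_of_le_one_left (abs_nonneg _) ht.2).trans (hcurl _ hz)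
    simpa using h
  obtain ⟨h1, h2⟩ := hφA x
  simp only [hAA'.self_of_nhdsSet x hxc, Prod.fst_sub, Prod.snd_sub] at h1 h2
  rw [h1, h2, one_mul]
  generalize (∫ t in (0 : ℝ)..1, t * curlA (fun y => A' y - A0 y) (c + t • (x - c))) = m at hint
  refine Real.sqrt_le_iff.2 ⟨by positivity, ?_⟩
  calc (-(x.2 - c.2) * m) ^ 2 + ((x.1 - c.1) * m) ^ 2
      = |m| ^ 2 * ((x.1 - c.1) ^ 2 + (x.2 - c.2) ^ 2) := by rw [sq_abs]; ring
    _ ≤ δ ^ 2 * r ^ 2 := by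
        have hxr : (x.1 - c.1) ^ 2 + (x.2 - c.2) ^ 2 ≤ r ^ 2 := hxc
        gcongr
    _ = (δ * r) ^ 2 := by ring
end
end
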